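/- Let Ω ⊆ ℂ² be a domain with smooth boundary and p ∈ ∂Ω with outward unit normal (1,0). Fix an integer r > 0. Then there is a neighborhood U of p and, for each boundary point q ∈ ∂Ω ∩ U, a polynomial automorphism Ψ_q of ℂ² (a composition of a translation, a dilation in the first coordinate, and triangular shear maps of the form (w,z) ↦ (w + 2h(z), z) with h a polynomial of degree ≤ r vanishing to order ≥ 1), depending continuously on q, such that Ψ_q(q) = (0,0) and Ψ_q(Ω ∩ U) is locally defined near the origin by Re w + P(z,z̄) + R(z,z̄) + Im(w/c)·Q(Im(w/c), z, z̄) < 0, where P is a real polynomial of degree ≤ r with no harmonic terms, c = c(q) satisfies Re c ≠ 0 and c(q) → 1 as q → p, ν(R) > r, and ν(Q) ≥ 1. -/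

import Mathlib

open Complex Filter Topology Asymptotics

/-- The polynomial `∑ C a b z^a z̄^b`, the sum running over `a, b ≤ n`. -/
noncomputable def mixedSum (n : ℕ) (C : ℕ → ℕ → ℂ) (z : ℂ) : ℂ :=
  ∑ a ∈ Finset.range (n + 1), ∑ b ∈ Finset.range (n + 1), C a b * z ^ a * (starRingEnd ℂ z) ^ b

/-- Coefficients of the polynomial with constant term `c` whose Wirtinger derivatives integrate
the polynomials with coefficients `A` and `B` along rays from the origin. -/
noncomputable def rayPrimitive (c : ℂ) (A B : ℕ → ℕ → ℂ) : ℕ → ℕ → ℂ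
  | 0, 0 => c
  | a + 1, 0 => A a 0 / (a + 1)
  | 0, b + 1 => B 0 b / (b + 1)
  | a + 1, b + 1 => (A a (b + 1) + B (a + 1) b) / (a + b + 2)

theorem mixedSum_add (n : ℕ) (C D : ℕ → ℕ → ℂ) (z : ℂ) :
    mixedSum n (fun a b => C a b + D a b) z = mixedSum n C z + mixedSum n D z := by
  simp only [mixedSum, add_mul, Finset.sum_add_distrib]

theorem mixedSum_sub (n : ℕ) (C D : ℕ → ℕ → ℂ) (z : ℂ) :
    mixedSum n (fun a b => C a b - D a b) z = mixedSum n C z - mixedSum n D z := by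
  simp only [mixedSum, sub_mul, Finset.sum_sub_distrib]

theorem mixedSum_succ_of_degree_le {n : ℕ} {C : ℕ → ℕ → ℂ} (hC : ∀ a b, n < a + b → C a b = 0)
    (z : ℂ) : mixedSum (n + 1) C z = mixedSum n C z := by
  unfold mixedSum
  rw [Finset.sum_range_succ, Finset.sum_eq_zero (s := Finset.range (n + 1 + 1)), add_zero]
  · refine Finset.sum_congr rfl fun a _ => ?_
    rw [Finset.sum_range_succ, hC a (n + 1) (by omega)]
    simp
  · intro b _
    rw [hC (n + 1) b (by omega)]
    simp

theorem rayPrimitive_eq_zero {n : ℕ} {c : ℂ} {A B : ℕ → ℕ → ℂ}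
    (hA : ∀ a b, n < a + b → A a b = 0) (hB : ∀ a b, n < a + b → B a b = 0) (a b : ℕ)
    (hab : n + 1 < a + b) : rayPrimitive c A B a b = 0 := by
  rcases a with _ | a <;> rcases b with _ | b
  · omega
  · simp [rayPrimitive, hB 0 b (by omega)]
  · simp [rayPrimitive, hA a 0 (by omega)]
  · simp [rayPrimitive, hA a (b + 1) (by omega), hB (a + 1) b (by omega)]

theorem contDiff_rayPrimitive {X : Type*} [NormedAddCommGroup X] [NormedSpace ℝ X]
    {c : X → ℂ} {A B : ℕ → ℕ → X → ℂ} (hc : ContDiff ℝ (⊤ : ℕ∞) c)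
    (hA : ∀ a b, ContDiff ℝ (⊤ : ℕ∞) (A a b)) (hB : ∀ a b, ContDiff ℝ (⊤ : ℕ∞) (B a b))
    (a b : ℕ) :
    ContDiff ℝ (⊤ : ℕ∞)
      fun θ => rayPrimitive (c θ) (fun a b => A a b θ) (fun a b => B a b θ) a b := by
  rcases a with _ | a <;> rcases b with _ | b
  · exact hc
  · exact (hB 0 b).div_const _
  · exact (hA a 0).div_const _
  · exact ((hA a (b + 1)).add (hB (a + 1) b)).div_const _

theorem mixedSum_rayPrimitive {n : ℕ} {c : ℂ} {A B : ℕ → ℕ → ℂ}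
    (hA : ∀ a b, n < a + b → A a b = 0) (hB : ∀ a b, n < a + b → B a b = 0) (z : ℂ) :
    mixedSum (n + 1) (rayPrimitive c A B) z =
      c + ∑ a ∈ Finset.range (n + 1), ∑ b ∈ Finset.range (n + 1),
        (A a b * z ^ (a + 1) * (starRingEnd ℂ z) ^ b +
          B a b * z ^ a * (starRingEnd ℂ z) ^ (b + 1)) / (a + b + 1) := by
  set w := starRingEnd ℂ z with hw
  have split : ∀ a b, rayPrimitive c A B a b = (if a = 0 ∧ b = 0 then c else 0) +
      ((if a = 0 then 0 else A (a - 1) b / (a + b)) +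
        (if b = 0 then 0 else B a (b - 1) / (a + b))) := by
    rintro (_ | a) (_ | b) <;> simp [rayPrimitive]
    ring
  have h0 : mixedSum (n + 1) (fun a b => if a = 0 ∧ b = 0 then c else 0) z = c := by
    unfold mixedSum
    rw [Finset.sum_range_succ', Finset.sum_range_succ']
    simp
  have h1 : mixedSum (n + 1) (fun a b => if a = 0 then 0 else A (a - 1) b / (a + b)) z =
      ∑ a ∈ Finset.range (n + 1), ∑ b ∈ Finset.range (n + 1),
        A a b * z ^ (a + 1) * w ^ b / (a + b + 1) := by
    unfold mixedSum
    rw [Finset.sum_range_succ']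
    simp only [if_true, zero_mul, Finset.sum_const_zero, add_zero]
    refine Finset.sum_congr rfl fun a _ => ?_
    rw [Finset.sum_range_succ]
    simp only [Nat.add_sub_cancel, hA a (n + 1) (by omega)]
    simp only [Nat.succ_ne_zero, if_false, zero_div, zero_mul, add_zero]
    refine Finset.sum_congr rfl fun b _ => ?_
    push_cast
    rw [← hw]
    ring
  have h2 : mixedSum (n + 1) (fun a b => if b = 0 then 0 else B a (b - 1) / (a + b)) z =
      ∑ a ∈ Finset.range (n + 1), ∑ b ∈ Finset.range (n + 1),
        B a b * z ^ a * w ^ (b + 1) / (a + b + 1) := by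
    unfold mixedSum
    rw [Finset.sum_range_succ, Finset.sum_eq_zero (s := Finset.range (n + 1 + 1)), add_zero]
    · refine Finset.sum_congr rfl fun a _ => ?_
      rw [Finset.sum_range_succ']
      simp only [if_true, zero_mul, add_zero, Nat.add_sub_cancel, Nat.succ_ne_zero, if_false]
      refine Finset.sum_congr rfl fun b _ => ?_
      push_cast
      rw [← hw]
      ring
    · rintro (_ | b) _
      · simp
      · simp [hB (n + 1) b (by omega)]
  rw [show rayPrimitive c A B = _ from funext fun a => funext fun b => split a b,
    mixedSum_add, mixedSum_add, h0, h1, h2, ← Finset.sum_add_distrib]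
  congr 1
  refine Finset.sum_congr rfl fun a _ => ?_
  rw [← Finset.sum_add_distrib]
  refine Finset.sum_congr rfl fun b _ => ?_
  ring

theorem hasDerivAt_mixedSum_rayPrimitive {n : ℕ} {c : ℂ} {A B : ℕ → ℕ → ℂ}
    (hA : ∀ a b, n < a + b → A a b = 0) (hB : ∀ a b, n < a + b → B a b = 0) (z : ℂ) (t : ℝ) :
    HasDerivAt (fun t : ℝ => mixedSum (n + 1) (rayPrimitive c A B) (t * z))
      (mixedSum n A (t * z) * z + mixedSum n B (t * z) * starRingEnd ℂ z) t := by
  set w := starRingEnd ℂ z with hw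
  have key : (fun t : ℝ => mixedSum (n + 1) (rayPrimitive c A B) (t * z)) = fun t : ℝ =>
      c + ∑ a ∈ Finset.range (n + 1), ∑ b ∈ Finset.range (n + 1),
        ((A a b * z ^ (a + 1) * w ^ b + B a b * z ^ a * w ^ (b + 1)) / (a + b + 1)) *
          (t : ℂ) ^ (a + b + 1) := by
    funext t
    rw [mixedSum_rayPrimitive hA hB]
    congr 1
    refine Finset.sum_congr rfl fun a _ => Finset.sum_congr rfl fun b _ => ?_
    simp only [map_mul, Complex.conj_ofReal, ← hw]
    ring
  rw [key]
  have hpow : ∀ m : ℕ, HasDerivAt (fun t : ℝ => (t : ℂ) ^ (m + 1)) ((m + 1) * (t : ℂ) ^ m) t := by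
    intro m
    have := (hasDerivAt_pow (m + 1) (t : ℂ)).comp_ofReal
    simpa using this
  have hs := HasDerivAt.fun_sum (u := Finset.range (n + 1)) (x := t) fun a _ =>
    HasDerivAt.fun_sum (u := Finset.range (n + 1)) fun b _ =>
      (hpow (a + b)).const_mul
        ((A a b * z ^ (a + 1) * w ^ b + B a b * z ^ a * w ^ (b + 1)) / (a + b + 1))
  refine (hs.const_add c).congr_deriv ?_
  unfold mixedSum
  rw [Finset.sum_mul, Finset.sum_mul, ← Finset.sum_add_distrib]
  refine Finset.sum_congr rfl fun a _ => ?_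
  rw [Finset.sum_mul, Finset.sum_mul, ← Finset.sum_add_distrib]
  refine Finset.sum_congr rfl fun b _ => ?_
  have : (a + b + 1 : ℂ) ≠ 0 := by exact_mod_cast Nat.succ_ne_zero (a + b)
  simp only [map_mul, Complex.conj_ofReal, ← hw]
  push_cast
  field_simp
  ring

theorem exists_smooth_taylor {X : Type*} [NormedAddCommGroup X] [NormedSpace ℝ X] (n : ℕ) :
    ∀ f : X × ℂ → ℂ, ContDiff ℝ (⊤ : ℕ∞) f → ∃ C : ℕ → ℕ → X → ℂ,
      (∀ a b, ContDiff ℝ (⊤ : ℕ∞) (C a b)) ∧ (∀ a b, n < a + b → C a b = 0) ∧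
      ∀ θ, (fun z => f (θ, z) - mixedSum n (fun a b => C a b θ) z) =o[𝓝 0]
        fun z : ℂ => ‖z‖ ^ n := by
  induction n with
  | zero =>
    intro f hf
    refine ⟨fun a b => if a = 0 ∧ b = 0 then fun θ => f (θ, 0) else 0, fun a b => ?_, ?_, ?_⟩
    · dsimp only
      split_ifs
      · exact hf.comp (contDiff_id.prodMk contDiff_const)
      · exact contDiff_const
    · intro a b h
      exact if_neg (by omega)
    · intro θ
      have : Tendsto (fun z : ℂ => f (θ, z) - f (θ, 0)) (𝓝 0) (𝓝 0) := by
        have h : Continuous fun z : ℂ => f (θ, z) - f (θ, 0) := by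
          have := hf.continuous
          fun_prop
        simpa using h.tendsto 0
      simpa [mixedSum, isLittleO_one_iff] using this
  | succ n ih =>
    intro f hf
    have hdir : ∀ v : ℂ, ContDiff ℝ (⊤ : ℕ∞) fun x : X × ℂ => fderiv ℝ f x (0, v) := fun v =>
      (hf.fderiv_right (m := (⊤ : ℕ∞)) (by simp)).clm_apply contDiff_const
    obtain ⟨A, hAs, hA0, hA⟩ := ih (fun x => (fderiv ℝ f x (0, 1) - I * fderiv ℝ f x (0, I)) / 2)
      (((hdir 1).sub (contDiff_const.mul (hdir I))).div_const 2)
    obtain ⟨B, hBs, hB0, hB⟩ := ih (fun x => (fderiv ℝ f x (0, 1) + I * fderiv ℝ f x (0, I)) / 2)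
      (((hdir 1).add (contDiff_const.mul (hdir I))).div_const 2)
    refine ⟨fun a b θ => rayPrimitive (f (θ, 0)) (fun a b => A a b θ) (fun a b => B a b θ) a b,
      contDiff_rayPrimitive (hf.comp (contDiff_id.prodMk contDiff_const)) hAs hBs, ?_, ?_⟩
    · intro a b h
      funext θ
      exact rayPrimitive_eq_zero (fun a b h => by rw [hA0 a b h]; rfl)
        (fun a b h => by rw [hB0 a b h]; rfl) a b h
    · intro θ
      have hA0' : ∀ a b, n < a + b → A a b θ = 0 := fun a b h => by rw [hA0 a b h]; rfl
      have hB0' : ∀ a b, n < a + b → B a b θ = 0 := fun a b h => by rw [hB0 a b h]; rfl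
      rw [isLittleO_iff]
      intro ε hε
      have hA' := isLittleO_iff.1 (hA θ) (half_pos hε)
      have hB' := isLittleO_iff.1 (hB θ) (half_pos hε)
      obtain ⟨δ, hδ, hball⟩ := Metric.eventually_nhds_iff.1 (hA'.and hB')
      refine Metric.eventually_nhds_iff.2 ⟨δ, hδ, fun z hz => ?_⟩
      rw [dist_zero_right] at hz
      have hder : ∀ t ∈ Set.Icc (0 : ℝ) 1, HasDerivWithinAt
          (fun t : ℝ => f (θ, t * z) - mixedSum (n + 1)
            (rayPrimitive (f (θ, 0)) (fun a b => A a b θ) fun a b => B a b θ) (t * z))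
          (fderiv ℝ f (θ, t * z) (0, z) -
            (mixedSum n (fun a b => A a b θ) (t * z) * z +
              mixedSum n (fun a b => B a b θ) (t * z) * starRingEnd ℂ z)) (Set.Icc 0 1) t := by
        intro t _
        have hline : HasDerivAt (fun t : ℝ => ((θ, (t : ℂ) * z) : X × ℂ)) (0, z) t := by
          have h1 : HasDerivAt (fun t : ℝ => (t : ℂ) * z) z t := by
            simpa using (Complex.ofRealCLM.hasDerivAt (x := t)).mul_const z
          exact (hasDerivAt_const t θ).prodMk h1
        have hfd := ((hf.differentiable (by simp)) (θ, t * z)).hasFDerivAt.comp_hasDerivAt t hline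
        exact (hfd.sub (hasDerivAt_mixedSum_rayPrimitive hA0' hB0' z t)).hasDerivWithinAt
      have hbound : ∀ t ∈ Set.Ico (0 : ℝ) 1, ‖fderiv ℝ f (θ, t * z) (0, z) -
            (mixedSum n (fun a b => A a b θ) (t * z) * z +
              mixedSum n (fun a b => B a b θ) (t * z) * starRingEnd ℂ z)‖ ≤ ε * ‖z‖ ^ (n + 1) := by
        intro t ht
        have htz : ‖(t : ℂ) * z‖ ≤ ‖z‖ := by
          rw [norm_mul, Complex.norm_real, Real.norm_of_nonneg ht.1]
          exact mul_le_of_le_one_left (norm_nonneg _) ht.2.le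
        obtain ⟨h1, h2⟩ := hball (y := (t : ℂ) * z)
          (by rw [dist_zero_right]; exact htz.trans_lt hz)
        have hpow : ‖‖(t : ℂ) * z‖ ^ n‖ ≤ ‖z‖ ^ n := by
          rw [norm_pow, norm_norm]
          exact pow_le_pow_left₀ (norm_nonneg _) htz n
        have hsplit : fderiv ℝ f (θ, t * z) (0, z) =
            (fderiv ℝ f (θ, t * z) (0, 1) - I * fderiv ℝ f (θ, t * z) (0, I)) / 2 * z +
            (fderiv ℝ f (θ, t * z) (0, 1) + I * fderiv ℝ f (θ, t * z) (0, I)) / 2 *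
              starRingEnd ℂ z := by
          have hz' : ((0, z) : X × ℂ) = z.re • (0, 1) + z.im • (0, I) := by
            ext
            · simp
            · simp
          conv_lhs => rw [hz', map_add, map_smul, map_smul]
          simp only [Complex.real_smul]
          have e1 : z + starRingEnd ℂ z = 2 * z.re := by simp [Complex.add_conj]
          have e2 : z - starRingEnd ℂ z = 2 * z.im * I := by simp [Complex.sub_conj]
          linear_combination -(fderiv ℝ f (θ, t * z) (0, 1) / 2) * e1 +
            (I * fderiv ℝ f (θ, t * z) (0, I) / 2) * e2 +
            z.im * fderiv ℝ f (θ, t * z) (0, I) * I_sq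
        rw [hsplit]
        calc _ = ‖((fderiv ℝ f (θ, t * z) (0, 1) - I * fderiv ℝ f (θ, t * z) (0, I)) / 2 -
                mixedSum n (fun a b => A a b θ) (t * z)) * z +
              ((fderiv ℝ f (θ, t * z) (0, 1) + I * fderiv ℝ f (θ, t * z) (0, I)) / 2 -
                mixedSum n (fun a b => B a b θ) (t * z)) * starRingEnd ℂ z‖ := by
              congr 1
              ring
          _ ≤ ε / 2 * ‖z‖ ^ n * ‖z‖ + ε / 2 * ‖z‖ ^ n * ‖z‖ := by
              refine (norm_add_le _ _).trans ?_
              rw [norm_mul, norm_mul, RCLike.norm_conj]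
              gcongr
              · exact h1.trans (by gcongr)
              · exact h2.trans (by gcongr)
          _ = ε * ‖z‖ ^ (n + 1) := by ring
      have hmv := norm_image_sub_le_of_norm_deriv_le_segment_01' hder hbound
      have h00 : mixedSum (n + 1)
          (rayPrimitive (f (θ, 0)) (fun a b => A a b θ) fun a b => B a b θ) 0 = f (θ, 0) := by
        rw [mixedSum_rayPrimitive hA0' hB0']
        simp
      simpa [h00] using hmv

theorem Polynomial.eq_zero_of_isLittleO {p : Polynomial ℝ} {n : ℕ} (hdeg : p.natDegree ≤ n)
    (ho : (fun t : ℝ => p.eval t) =o[𝓝 0] fun t : ℝ => t ^ n) : p = 0 := by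
  by_contra hp
  obtain ⟨q, hq, hndvd⟩ := p.exists_eq_pow_rootMultiplicity_mul_and_not_dvd hp 0
  set m := p.rootMultiplicity 0
  have hm : m ≤ n := by
    have := Polynomial.natDegree_le_of_dvd (p.pow_rootMultiplicity_dvd 0) hp
    rw [Polynomial.natDegree_pow, Polynomial.natDegree_X_sub_C, mul_one] at this
    exact this.trans hdeg
  have hq0 : q.eval 0 ≠ 0 := fun h => hndvd (Polynomial.dvd_iff_isRoot.2 h)
  have h1 : (fun t : ℝ => q.eval t) =o[𝓝[≠] 0] fun _ : ℝ => (1 : ℝ) := by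
    rw [isLittleO_iff]
    intro ε hε
    have h2 := (isLittleO_iff.1 ho hε).filter_mono (nhdsWithin_le_nhds (s := {0}ᶜ))
    have h3 : ∀ᶠ t : ℝ in 𝓝[≠] 0, |t| < 1 := by
      refine Filter.Eventually.filter_mono nhdsWithin_le_nhds ?_
      exact continuous_abs.continuousAt.eventually_lt continuousAt_const (by simp)
    filter_upwards [h2, h3, self_mem_nhdsWithin] with t ht ht1 ht0
    have htm : 0 < |t| ^ m := pow_pos (abs_pos.2 ht0) m
    rw [hq] at ht
    simp only [Polynomial.eval_mul, Polynomial.eval_pow, Polynomial.eval_sub, Polynomial.eval_X,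
      Polynomial.eval_C, sub_zero, norm_mul, norm_pow, Real.norm_eq_abs] at ht
    have : |t| ^ n ≤ |t| ^ m := pow_le_pow_of_le_one (abs_nonneg t) ht1.le hm
    have h4 : |t| ^ m * |q.eval t| ≤ |t| ^ m * ε := by nlinarith
    simpa using le_of_mul_le_mul_left h4 htm
  have h2 : Tendsto (fun t : ℝ => q.eval t) (𝓝[≠] 0) (𝓝 (q.eval 0)) :=
    (q.continuous.tendsto 0).mono_left nhdsWithin_le_nhds
  exact hq0 (tendsto_nhds_unique h2 ((isLittleO_one_iff ℝ).1 h1))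

theorem re_mixedSum_eq_zero_of_isLittleO {n : ℕ} {C : ℕ → ℕ → ℂ}
    (hC : ∀ a b, n < a + b → C a b = 0)
    (ho : (fun z => (mixedSum n C z).re) =o[𝓝 0] fun z : ℂ => ‖z‖ ^ n) (z : ℂ) :
    (mixedSum n C z).re = 0 := by
  set p : Polynomial ℝ := ∑ a ∈ Finset.range (n + 1), ∑ b ∈ Finset.range (n + 1),
    Polynomial.monomial (a + b) (C a b * z ^ a * (starRingEnd ℂ z) ^ b).re with hp
  have heval : ∀ t : ℝ, p.eval t = (mixedSum n C (t * z)).re := by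
    intro t
    simp only [hp, mixedSum, Polynomial.eval_finsetSum, Complex.re_sum, Polynomial.eval_monomial]
    refine Finset.sum_congr rfl fun a _ => Finset.sum_congr rfl fun b _ => ?_
    rw [← Complex.re_mul_ofReal]
    congr 1
    push_cast
    simp only [map_mul, Complex.conj_ofReal]
    ring
  have hdeg : p.natDegree ≤ n := by
    refine Polynomial.natDegree_sum_le_of_forall_le _ _ fun a _ =>
      Polynomial.natDegree_sum_le_of_forall_le _ _ fun b _ => ?_
    rcases le_or_gt (a + b) n with h | h
    · exact (Polynomial.natDegree_monomial_le _).trans h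
    · simp [hC a b h]
  have hlim : Tendsto (fun t : ℝ => (t : ℂ) * z) (𝓝 0) (𝓝 0) := by
    have : Continuous fun t : ℝ => (t : ℂ) * z := by fun_prop
    simpa using this.tendsto 0
  have hp0 : p = 0 := by
    refine Polynomial.eq_zero_of_isLittleO hdeg ?_
    simp only [heval]
    refine (ho.comp_tendsto hlim).trans_isBigO ?_
    refine IsBigO.of_bound (‖z‖ ^ n) (Eventually.of_forall fun t => ?_)
    simp [mul_pow, mul_comm]
  simpa [hp0] using (heval 1).symm

theorem isLittleO_sub_of_fderiv_eq_zero {H : ℝ × ℂ → ℝ} (hH : ContDiff ℝ (⊤ : ℕ∞) H)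
    (hd : fderiv ℝ H 0 (1, 0) = 0) {s t : ℂ → ℝ} (hs : Tendsto s (𝓝 0) (𝓝 0))
    (ht : Tendsto t (𝓝 0) (𝓝 0)) :
    (fun z => H (s z, z) - H (t z, z)) =o[𝓝 0] fun z => s z - t z := by
  have hstrict : HasStrictFDerivAt H (fderiv ℝ H 0) 0 :=
    hH.contDiffAt.hasStrictFDerivAt (by simp)
  have hlim : Tendsto (fun z : ℂ => ((s z, z), (t z, z))) (𝓝 0) (𝓝 ((0 : ℝ × ℂ), (0 : ℝ × ℂ))) :=
    (hs.prodMk_nhds tendsto_id).prodMk_nhds (ht.prodMk_nhds tendsto_id)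
  have h := hstrict.isLittleO.comp_tendsto hlim
  have hL : ∀ x : ℝ, fderiv ℝ H 0 (x, 0) = 0 := fun x => by
    have : ((x, 0) : ℝ × ℂ) = x • (1, 0) := by simp
    rw [this, map_smul, hd, smul_zero]
  refine (h.congr_left fun z => ?_).trans_isBigO (IsBigO.of_bound 1 (Eventually.of_forall ?_))
  · simp only [Function.comp, Prod.mk_sub_mk, sub_self, hL, sub_zero]
  · intro z
    simp [Prod.norm_def]

theorem exists_smooth_normalization {X : Type*} [NormedAddCommGroup X] [NormedSpace ℝ X]
    {H : X × (ℝ × ℂ) → ℝ} (hH : ContDiff ℝ (⊤ : ℕ∞) H) (h0 : ∀ θ, H (θ, 0) = 0)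
    (hd : ∀ θ, fderiv ℝ (fun v => H (θ, v)) 0 (1, 0) = 0)
    {c : X → ℂ} (hc : ContDiff ℝ (⊤ : ℕ∞) c) (hc0 : ∀ θ, c θ ≠ 0) (k : ℕ) :
    ∃ a : ℕ → X → ℂ, (∀ j, ContDiff ℝ (⊤ : ℕ∞) (a j)) ∧ a 0 = 0 ∧
      ∀ θ, ∃ C : ℕ → ℕ → ℂ, (∀ a b, k < a + b → C a b = 0) ∧ (∀ a, C a 0 = 0 ∧ C 0 a = 0) ∧
        (fun z : ℂ => H (θ, (-((∑ j ∈ Finset.range (k + 1), a j θ * z ^ j) / c θ).im, z)) -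
            (∑ j ∈ Finset.range (k + 1), a j θ * z ^ j).re - (mixedSum k C z).re)
          =o[𝓝 0] fun z : ℂ => ‖z‖ ^ k := by
  have hslice : ∀ θ, ContDiff ℝ (⊤ : ℕ∞) fun v => H (θ, v) := fun θ =>
    hH.comp (contDiff_const.prodMk contDiff_id)
  induction k with
  | zero =>
    refine ⟨fun _ => 0, fun _ => contDiff_const, rfl, fun θ => ⟨fun _ _ => 0, by simp, by simp, ?_⟩⟩
    have h : Continuous fun z : ℂ => H (θ, (0, z)) := by
      have := hH.continuous
      fun_prop
    have : Tendsto (fun z : ℂ => H (θ, (0, z))) (𝓝 0) (𝓝 0) := by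
      have h' := h.tendsto 0
      rwa [show ((0 : ℝ), (0 : ℂ)) = 0 from rfl, h0] at h'
    simpa [mixedSum, isLittleO_one_iff] using this
  | succ k ih =>
    obtain ⟨a, has, ha0, ha⟩ := ih
    set S : X → ℂ → ℂ := fun θ z => ∑ j ∈ Finset.range (k + 1), a j θ * z ^ j with hS
    have hSs : ContDiff ℝ (⊤ : ℕ∞) fun x : X × ℂ => S x.1 x.2 :=
      ContDiff.sum fun j _ => ((has j).comp contDiff_fst).mul (contDiff_snd.pow j)
    have hS0 : ∀ θ, S θ 0 = 0 := fun θ => by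
      simp [hS, Finset.sum_range_succ', ha0]
    have hfs : ContDiff ℝ (⊤ : ℕ∞) fun x : X × ℂ =>
        H (x.1, (-(S x.1 x.2 / c x.1).im, x.2)) - (S x.1 x.2).re := by
      have hdiv : ContDiff ℝ (⊤ : ℕ∞) fun x : X × ℂ => S x.1 x.2 / c x.1 :=
        hSs.mul ((hc.comp contDiff_fst).inv fun x => hc0 x.1)
      exact (hH.comp (contDiff_fst.prodMk
        ((Complex.imCLM.contDiff.comp hdiv).neg.prodMk contDiff_snd))).sub
        (Complex.reCLM.contDiff.comp hSs)
    obtain ⟨D, hDs, hD0, hD⟩ := exists_smooth_taylor (k + 1) _ (Complex.ofRealCLM.contDiff.comp hfs)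
    have hD' : ∀ θ, (fun z : ℂ => H (θ, (-(S θ z / c θ).im, z)) - (S θ z).re -
        (mixedSum (k + 1) (fun a b => D a b θ) z).re) =o[𝓝 0] fun z : ℂ => ‖z‖ ^ (k + 1) := by
      intro θ
      refine (IsBigO.of_bound 1 (Eventually.of_forall fun z => ?_)).trans_isLittleO (hD θ)
      rw [one_mul]
      refine le_trans (le_of_eq ?_) (Complex.abs_re_le_norm _)
      simp
    set e : X → ℂ := fun θ => D (k + 1) 0 θ + starRingEnd ℂ (D 0 (k + 1) θ) with he
    have hes : ContDiff ℝ (⊤ : ℕ∞) e :=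
      (hDs _ _).add (Complex.conjCLE.contDiff.comp (hDs _ _))
    refine ⟨Function.update a (k + 1) e, fun j => ?_, ?_, fun θ => ?_⟩
    · rcases eq_or_ne j (k + 1) with rfl | hj
      · simpa using hes
      · simpa [hj] using has j
    · rw [Function.update_of_ne (by omega), ha0]
    obtain ⟨C, hC0, hCh, hC⟩ := ha θ
    have hsum : ∀ z : ℂ, ∑ j ∈ Finset.range (k + 1 + 1), Function.update a (k + 1) e j θ * z ^ j =
        S θ z + e θ * z ^ (k + 1) := by
      intro z
      rw [Finset.sum_range_succ, Function.update_self]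
      congr 1
      refine Finset.sum_congr rfl fun j hj => ?_
      rw [Function.update_of_ne (Finset.mem_range.1 hj).ne]
    simp only [hsum]
    -- The part of degree at most `k` of the new expansion agrees with the old one.
    set L : ℕ → ℕ → ℂ := fun a b => if a + b ≤ k then D a b θ else 0 with hL
    set T : ℕ → ℕ → ℂ := fun a b => if a + b = k + 1 then D a b θ else 0 with hT
    have hLT : ∀ z, mixedSum (k + 1) (fun a b => D a b θ) z =
        mixedSum k L z + mixedSum (k + 1) T z := by
      intro z
      rw [← mixedSum_succ_of_degree_le (C := L) (fun a b h => if_neg (by omega)), ← mixedSum_add]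
      congr 1
      funext a b
      rcases lt_trichotomy (a + b) (k + 1) with h | h | h
      · simp [hL, hT, h.ne, Nat.lt_succ_iff.1 h]
      · simp [hL, hT, h]
      · simp [hL, hT, h.ne', hD0 a b h, show ¬ a + b ≤ k by omega]
    have hTo : (fun z => (mixedSum (k + 1) T z).re) =o[𝓝 0] fun z : ℂ => ‖z‖ ^ k := by
      have hbig : (fun z => (mixedSum (k + 1) T z).re) =O[𝓝 0] fun z : ℂ => ‖z‖ ^ (k + 1) := by
        refine (IsBigO.of_bound 1 (Eventually.of_forall fun z => ?_)).trans
          (g := fun z => mixedSum (k + 1) T z) ?_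
        · simpa using Complex.abs_re_le_norm _
        · refine IsBigO.fun_sum fun a _ => IsBigO.fun_sum fun b _ => ?_
          refine IsBigO.of_bound ‖T a b‖ (Eventually.of_forall fun z => ?_)
          by_cases h : a + b = k + 1
          · simp [← h, pow_add, mul_assoc]
          · simp [hT, h]
      exact hbig.trans_isLittleO (isLittleO_norm_pow_norm_pow (Nat.lt_succ_self k))
    have hpow : (fun z : ℂ => ‖z‖ ^ (k + 1)) =O[𝓝 0] fun z : ℂ => ‖z‖ ^ k :=
      (isLittleO_norm_pow_norm_pow (Nat.lt_succ_self k)).isBigO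
    have hLC : ∀ z, (mixedSum k L z).re = (mixedSum k C z).re := by
      intro z
      have hz := re_mixedSum_eq_zero_of_isLittleO (n := k) (C := fun a b => L a b - C a b)
        (fun a b h => by simp [hL, hC0 a b h, h.not_ge]) ?_ z
      · rw [mixedSum_sub, Complex.sub_re] at hz
        linarith
      · refine ((hC.sub ((hD' θ).trans_isBigO hpow)).sub hTo).congr_left fun z => ?_
        rw [hLT, mixedSum_sub, Complex.sub_re, Complex.add_re]
        ring
    refine ⟨fun a b => C a b + if a = 0 ∨ b = 0 then 0 else T a b, ?_, ?_, ?_⟩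
    · intro a b h
      simp [hC0 a b (by omega), hT, h.ne']
    · intro a
      simp [hCh a]
    -- The harmonic terms of degree `k + 1` are the real part of `e z^(k+1)`.
    have hpure : ∀ z, (mixedSum (k + 1) T z).re =
        (mixedSum (k + 1) (fun a b => if a = 0 ∨ b = 0 then 0 else T a b) z).re +
          (e θ * z ^ (k + 1)).re := by
      intro z
      have hsplit : T = fun a b => (if a = 0 ∨ b = 0 then 0 else T a b) +
          (if a = 0 ∨ b = 0 then T a b else 0) := by
        funext a b
        split_ifs <;> simp
      conv_lhs => rw [hsplit]
      rw [mixedSum_add, Complex.add_re]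
      congr 1
      have : mixedSum (k + 1) (fun a b => if a = 0 ∨ b = 0 then T a b else 0) z =
          D (k + 1) 0 θ * z ^ (k + 1) + D 0 (k + 1) θ * (starRingEnd ℂ z) ^ (k + 1) := by
        unfold mixedSum
        rw [Finset.sum_range_succ', Finset.sum_range_succ]
        have hin : ∀ x ∈ Finset.range k, ∑ b ∈ Finset.range (k + 1 + 1),
            (if x + 1 = 0 ∨ b = 0 then T (x + 1) b else 0) * z ^ (x + 1) *
              (starRingEnd ℂ z) ^ b = 0 := by
          intro x hx
          refine Finset.sum_eq_zero fun b _ => ?_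
          have := Finset.mem_range.1 hx
          rcases eq_or_ne b 0 with rfl | hb
          · simp [hT, this.ne]
          · simp [hb]
        rw [Finset.sum_eq_zero hin, zero_add, Finset.sum_eq_single 0, Finset.sum_eq_single (k + 1)]
        · simp [hT]
        · intro b _ hb
          simp [hT, hb]
        · simp
        · intro b _ hb
          simp [hb]
        · simp
      rw [this, he]
      simp only [add_mul, Complex.add_re]
      congr 1
      rw [← Complex.conj_re, map_mul, map_pow, Complex.conj_conj]
    have hSt : Tendsto (fun z => S θ z) (𝓝 0) (𝓝 0) := by
      have h : Continuous fun z => S θ z := by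
        have := hSs.continuous
        fun_prop
      simpa [hS0] using h.tendsto 0
    have hlim : ∀ g : ℂ → ℂ, Continuous g → g 0 = 0 →
        Tendsto (fun z => -((g z) / c θ).im) (𝓝 0) (𝓝 0) := by
      intro g hg hg0
      have h : Continuous fun z => -((g z) / c θ).im := by fun_prop
      simpa [hg0] using h.tendsto 0
    have hScont : Continuous fun z => S θ z := by
      have := hSs.continuous
      fun_prop
    have hE : (fun z => H (θ, (-((S θ z + e θ * z ^ (k + 1)) / c θ).im, z)) -
        H (θ, (-(S θ z / c θ).im, z))) =o[𝓝 0] fun z : ℂ => ‖z‖ ^ (k + 1) := by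
      refine (isLittleO_sub_of_fderiv_eq_zero (hslice θ) (hd θ)
        (hlim (fun z => S θ z + e θ * z ^ (k + 1)) (by fun_prop) (by simp [hS0]))
        (hlim (S θ) hScont (hS0 θ))).trans_isBigO ?_
      refine IsBigO.of_bound ‖e θ / c θ‖ (Eventually.of_forall fun z => ?_)
      have : -((S θ z + e θ * z ^ (k + 1)) / c θ).im - -(S θ z / c θ).im =
          -(e θ / c θ * z ^ (k + 1)).im := by
        rw [add_div, Complex.add_im, mul_div_right_comm]
        ring
      rw [this, norm_neg]
      refine (Complex.abs_im_le_norm _).trans ?_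
      simp
    refine (hE.add (hD' θ)).congr_left fun z => ?_
    rw [mixedSum_add, mixedSum_succ_of_degree_le hC0, hLT, Complex.add_re, Complex.add_re,
      Complex.add_re, hLC, hpure]
    ring

theorem exists_smooth_implicit {E : Type*} [NormedAddCommGroup E] [NormedSpace ℝ E]
    [CompleteSpace E] {f : E × ℝ → ℝ} (hf : ContDiff ℝ (⊤ : ℕ∞) f) {u : E × ℝ} (hu : f u = 0)
    (hd : fderiv ℝ f u (0, 1) ≠ 0) :
    ∃ ψ : E → ℝ, ψ u.1 = u.2 ∧ (∀ᶠ x in 𝓝 u.1, ContDiffAt ℝ (⊤ : ℕ∞) ψ x) ∧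
      ∀ᶠ x in 𝓝 u.1, f (x, ψ x) = 0 := by
  have hne : ((⊤ : ℕ∞) : WithTop ℕ∞) ≠ 0 := by simp
  have hinv : ∀ v : E × ℝ, fderiv ℝ f v (0, 1) ≠ 0 →
      (fderiv ℝ f v ∘L .inr ℝ E ℝ).IsInvertible := by
    intro v hv
    refine ⟨ContinuousLinearEquiv.unitsEquivAut ℝ (Units.mk0 _ hv), ?_⟩
    ext
    simp
  have hcf : ∀ v, ContDiffAt ℝ (⊤ : ℕ∞) f v := fun v => hf.contDiffAt
  set ψ := (hcf u).implicitFunction hne (hinv u hd) with hψ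
  have hψu : ψ u.1 = u.2 := (hcf u).implicitFunction_apply_self hne (hinv u hd)
  have hz : ∀ᶠ x in 𝓝 u.1, f (x, ψ x) = 0 := by
    simpa [hu] using (hcf u).eventually_apply_implicitFunction hne (hinv u hd)
  have hsm : ContDiffAt ℝ (⊤ : ℕ∞) ψ u.1 := (hcf u).contDiffAt_implicitFunction hne (hinv u hd)
  have hcont : ∀ᶠ x in 𝓝 u.1, ContinuousAt ψ x :=
    ((hsm.of_le (m := 1) (by exact_mod_cast le_top)).eventually (by simp)).mono
      fun x hx => hx.continuousAt
  have hnz : ∀ᶠ x in 𝓝 u.1, fderiv ℝ f (x, ψ x) (0, 1) ≠ 0 := by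
    have h1 : Continuous fun v : E × ℝ => fderiv ℝ f v (0, 1) :=
      (hf.continuous_fderiv (by simp)).clm_apply continuous_const
    have h2 : ContinuousAt (fun x => fderiv ℝ f (x, ψ x) (0, 1)) u.1 :=
      h1.continuousAt.comp (continuousAt_id.prodMk hsm.continuousAt)
    exact h2.eventually_ne (by simpa [hψu] using hd)
  refine ⟨ψ, hψu, ?_, hz⟩
  filter_upwards [hcont, hnz, hz.eventually_nhds, hz] with x hx hx1 hx2 hx0
  have hev := (hcf (x, ψ x)).eventually_apply_eq_iff_implicitFunction hne (hinv _ hx1)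
  have hev' : ∀ᶠ y in 𝓝 x, f (y, ψ y) = f (x, ψ x) ↔
      (hcf (x, ψ x)).implicitFunction hne (hinv _ hx1) y = ψ y :=
    (continuousAt_id.prodMk hx : ContinuousAt (fun y => (y, ψ y)) x).eventually hev
  refine ((hcf (x, ψ x)).contDiffAt_implicitFunction hne (hinv _ hx1)).congr_of_eventuallyEq ?_
  filter_upwards [hev', hx2] with y hy hy0
  exact (hy.1 (by rw [hy0, hx0])).symm

theorem exists_contDiff_eventuallyEq {E : Type*} [NormedAddCommGroup E] [NormedSpace ℝ E]
    [FiniteDimensional ℝ E] {ψ : E → ℝ} {x : E}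
    (hψ : ∀ᶠ y in 𝓝 x, ContDiffAt ℝ (⊤ : ℕ∞) ψ y) :
    ∃ g : E → ℝ, ContDiff ℝ (⊤ : ℕ∞) g ∧ g =ᶠ[𝓝 x] ψ := by
  obtain ⟨ε, hε, hball⟩ := Metric.eventually_nhds_iff_ball.1 hψ
  let b : ContDiffBump x := ⟨ε / 4, ε / 2, by positivity, by linarith⟩
  refine ⟨fun y => b y * ψ y, contDiff_iff_contDiffAt.2 fun y => ?_, ?_⟩
  · rcases lt_or_ge (dist y x) ε with hy | hy
    · exact b.contDiffAt.mul (hball y hy)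
    · have : (fun y => b y * ψ y) =ᶠ[𝓝 y] fun _ => 0 := by
        have hlt : ∀ᶠ z in 𝓝 y, ε / 2 < dist z x :=
          continuousAt_const.eventually_lt (by fun_prop) (by linarith)
        filter_upwards [hlt] with z hz
        rw [b.zero_of_le_dist hz.le, zero_mul]
      exact contDiffAt_const.congr_of_eventuallyEq this
  · filter_upwards [b.eventuallyEq_one] with y hy
    simp [hy]

theorem exists_smooth_graph {d : ℂ × ℂ → ℝ} (hd : ContDiff ℝ (⊤ : ℕ∞) d) {p : ℂ × ℂ}
    (hp : d p = 0) {c₀ : ℝ} (hc₀ : 0 < c₀) (hnormal : ∀ v : ℂ × ℂ, fderiv ℝ d p v = c₀ * v.1.re) :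
    ∃ g : ℝ × ℂ → ℝ, ContDiff ℝ (⊤ : ℕ∞) g ∧ fderiv ℝ g (p.1.im, p.2) (1, 0) = 0 ∧
      ∀ᶠ w in 𝓝 p, (d w < 0 ↔ w.1.re < g (w.1.im, w.2)) ∧
        (d w = 0 ↔ w.1.re = g (w.1.im, w.2)) := by
  let ι : (ℝ × ℂ) × ℝ →L[ℝ] ℂ × ℂ :=
    ((Complex.ofRealCLM ∘L .snd ℝ (ℝ × ℂ) ℝ) +
      I • (Complex.ofRealCLM ∘L .fst ℝ ℝ ℂ ∘L .fst ℝ (ℝ × ℂ) ℝ)).prod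
    (.snd ℝ ℝ ℂ ∘L .fst ℝ (ℝ × ℂ) ℝ)
  have hι : ∀ v, ι v = (v.2 + I * v.1.1, v.1.2) := fun v => rfl
  have hιw : ∀ w : ℂ × ℂ, ι ((w.1.im, w.2), w.1.re) = w := fun w => by
    rw [hι, mul_comm, Complex.re_add_im]
  have hdd : Differentiable ℝ d := hd.differentiable (by simp)
  have hfd : ∀ u v, fderiv ℝ (fun x => d (ι x)) u v = fderiv ℝ d (ι u) (ι v) := fun u v => by
    have := (hdd (ι u)).hasFDerivAt.comp u ι.hasFDerivAt
    exact congrArg (fun L : (ℝ × ℂ) × ℝ →L[ℝ] ℝ => L v) this.fderiv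
  obtain ⟨ψ, hψ, hψs, hψ0⟩ := exists_smooth_implicit (hd.comp ι.contDiff)
    (u := ((p.1.im, p.2), p.1.re)) (by simp only [Function.comp, hιw, hp])
    (by
      have := hfd ((p.1.im, p.2), p.1.re) (0, 1)
      rw [hιw, hnormal, hι] at this
      refine ne_of_eq_of_ne this ?_
      simpa using hc₀.ne')
  obtain ⟨g, hg, hgψ⟩ := exists_contDiff_eventuallyEq hψs
  have hg0 : ∀ᶠ x in 𝓝 (p.1.im, p.2), d (ι (x, g x)) = 0 := by
    filter_upwards [hgψ, hψ0] with x h1 h2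
    rw [h1]
    exact h2
  have hgp : g (p.1.im, p.2) = p.1.re := hgψ.eq_of_nhds.trans hψ
  refine ⟨g, hg, ?_, ?_⟩
  · have hgd := (hg.differentiable (by simp) (p.1.im, p.2)).hasFDerivAt
    have h1 := (hdd (ι ((p.1.im, p.2), g (p.1.im, p.2)))).hasFDerivAt.comp (p.1.im, p.2)
      (ι.hasFDerivAt.comp (p.1.im, p.2) ((hasFDerivAt_id (p.1.im, p.2)).prodMk hgd))
    have h2 : HasFDerivAt (fun x => d (ι (x, g x))) (0 : ℝ × ℂ →L[ℝ] ℝ) (p.1.im, p.2) :=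
      (hasFDerivAt_const (0 : ℝ) _).congr_of_eventuallyEq hg0
    have h3 := congrArg (fun L : ℝ × ℂ →L[ℝ] ℝ => L (1, 0)) (h1.unique h2)
    rw [hgp, hιw] at h3
    simp [hnormal, hι, hc₀.ne'] at h3
    exact h3
  · have hpos : ∀ᶠ w in 𝓝 p, 0 < fderiv ℝ d w (1, 0) := by
      have h1 : Continuous fun w => fderiv ℝ d w (1, 0) :=
        (hd.continuous_fderiv (by simp)).clm_apply continuous_const
      exact continuousAt_const.eventually_lt h1.continuousAt (by simp [hnormal, hc₀])
    obtain ⟨ε, hε, hball⟩ := Metric.eventually_nhds_iff_ball.1 hpos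
    have hproj : Continuous fun w : ℂ × ℂ => (w.1.im, w.2) := by fun_prop
    have hfoot : ∀ᶠ w in 𝓝 p, ι ((w.1.im, w.2), g (w.1.im, w.2)) ∈ Metric.ball p ε := by
      have h1 : Continuous fun w : ℂ × ℂ => ι ((w.1.im, w.2), g (w.1.im, w.2)) := by
        have := hg.continuous
        fun_prop
      refine h1.continuousAt.eventually_mem (Metric.isOpen_ball.mem_nhds ?_)
      rw [hgp, hιw]
      exact Metric.mem_ball_self hε
    filter_upwards [hfoot, Metric.ball_mem_nhds p hε, hproj.continuousAt.eventually hg0]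
      with w hw1 hw2 hw3
    set u : ℝ × ℂ := (w.1.im, w.2) with hu
    set J : Set ℝ := {x | ι (u, x) ∈ Metric.ball p ε} with hJ
    have hJconv : Convex ℝ J := by
      have : J = (ContinuousLinearMap.inr ℝ (ℝ × ℂ) ℝ) ⁻¹'
          ((fun v => (u, (0 : ℝ)) + v) ⁻¹' (ι ⁻¹' Metric.ball p ε)) := by
        ext x
        simp [hJ]
      rw [this]
      exact (((convex_ball p ε).linear_preimage ι.toLinearMap).translate_preimage_right
        _).linear_preimage (ContinuousLinearMap.inr ℝ (ℝ × ℂ) ℝ).toLinearMap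
    have hder : ∀ x, HasDerivAt (fun x => d (ι (u, x))) (fderiv ℝ d (ι (u, x)) (1, 0)) x := by
      intro x
      have h1 : HasDerivAt (fun x : ℝ => ι (u, x)) (ι (0, 1)) x :=
        ι.hasFDerivAt.comp_hasDerivAt x ((hasDerivAt_const x u).prodMk (hasDerivAt_id x))
      have h2 := (hdd (ι (u, x))).hasFDerivAt.comp_hasDerivAt x h1
      have h3 : ι (0, 1) = (1, 0) := by simp [hι]
      exact h2.congr_deriv (by rw [h3])
    have hmono : StrictMonoOn (fun x => d (ι (u, x))) J :=
      strictMonoOn_of_hasDerivWithinAt_pos hJconv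
        (fun x _ => (hder x).continuousAt.continuousWithinAt)
        (fun x _ => (hder x).hasDerivWithinAt)
        fun x hx => hball _ (interior_subset hx : x ∈ J)
    have hwJ : w.1.re ∈ J := by
      change ι (u, w.1.re) ∈ Metric.ball p ε
      rw [hu, hιw]
      exact hw2
    have hval : d (ι (u, w.1.re)) = d w := by rw [hu, hιw]
    have hlt := hmono.lt_iff_lt hwJ hw1
    have heq := hmono.eq_iff_eq hwJ hw1
    simp only [hval, hw3] at hlt heq
    exact ⟨hlt, heq⟩

theorem exists_divided_difference {H : ℝ × ℂ → ℝ} (hH : ContDiff ℝ (⊤ : ℕ∞) H) {Y : ℂ → ℝ}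
    (hY : Continuous Y) :
    ∃ Q : ℝ → ℂ → ℝ, Continuous (fun tz : ℝ × ℂ => Q tz.1 tz.2) ∧
      Q 0 0 = fderiv ℝ H (Y 0, 0) (1, 0) ∧
      ∀ s z, H (s + Y z, z) = H (Y z, z) + s * Q s z := by
  have hcont : Continuous fun v => fderiv ℝ H v (1, 0) :=
    (hH.continuous_fderiv (by simp)).clm_apply continuous_const
  refine ⟨fun s z => ∫ t in (0 : ℝ)..1, fderiv ℝ H (t * s + Y z, z) (1, 0), ?_, by simp, ?_⟩
  · refine intervalIntegral.continuous_parametric_intervalIntegral_of_continuous'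
      (f := fun (x : ℝ × ℂ) (t : ℝ) => fderiv ℝ H (t * x.1 + Y x.2, x.2) (1, 0)) ?_ 0 1
    exact hcont.comp (by fun_prop)
  · intro s z
    have hder : ∀ t ∈ Set.uIcc (0 : ℝ) 1, HasDerivAt (fun t : ℝ => H (t * s + Y z, z))
        (s * fderiv ℝ H (t * s + Y z, z) (1, 0)) t := by
      intro t _
      have h1 : HasDerivAt (fun t : ℝ => ((t * s + Y z, z) : ℝ × ℂ)) (s, 0) t :=
        (by simpa using ((hasDerivAt_id t).mul_const s).add_const (Y z) :
          HasDerivAt (fun t : ℝ => t * s + Y z) s t).prodMk (hasDerivAt_const t z)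
      have h2 := (hH.differentiable (by simp) (t * s + Y z, z)).hasFDerivAt.comp_hasDerivAt t h1
      refine h2.congr_deriv ?_
      rw [show ((s, 0) : ℝ × ℂ) = s • (1, 0) by simp, map_smul, smul_eq_mul]
    have hint := intervalIntegral.integral_eq_sub_of_hasDerivAt hder
      ((continuous_const.mul (hcont.comp (by fun_prop))).intervalIntegrable 0 1)
    rw [intervalIntegral.integral_const_mul] at hint
    simp only [one_mul, zero_mul, zero_add] at hint
    linarith

/-- Proposition 2.3: admissible continuously-varying coordinate system.
For a domain `Ω ⊆ ℂ²` with smooth boundary (encoded by a smooth local defining function `d`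
with nonvanishing gradient) and `p ∈ ∂Ω` with outward unit normal `(1,0)`, and `r > 0`,
there are a neighborhood `U` of `p` and maps `Ψ_q` for `q ∈ ∂Ω ∩ U`, each the composition of
a translation, a dilation and triangular (shear) maps — explicitly
`Ψ_q(w,z) = (c(q)·(w−q₁) + h_q(z−q₂), z−q₂)` with `h_q` a polynomial of degree `≤ r`
vanishing at `0` — depending continuously on `q`, with `Ψ_q(q) = 0`, `Re c(q) ≠ 0`,
`c(q) → 1` as `q → p`, such that `Ψ_q(Ω ∩ U)` is defined near the origin by
`Re w + P(z,z̄) + R(z,z̄) + Im(w/c)·Q(Im(w/c),z,z̄) < 0`, where `P` is a real polynomial of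
degree `≤ r` with no harmonic terms, `ν(R) > r` and `ν(Q) ≥ 1`. -/
theorem admissible_coords_stmt19
    (Ω : Set (ℂ × ℂ)) (hΩopen : IsOpen Ω) (hΩconn : IsConnected Ω)
    (p : ℂ × ℂ) (hp : p ∈ frontier Ω)
    (r : ℕ) (hr : 0 < r)
    (d : ℂ × ℂ → ℝ) (hd : ContDiff ℝ (⊤ : ℕ∞) d)
    (V : Set (ℂ × ℂ)) (hV : V ∈ 𝓝 p)
    (hdef : Ω ∩ V = {z ∈ V | d z < 0})
    (hbdry : frontier Ω ∩ V = {z ∈ V | d z = 0})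
    (hgrad : ∀ z ∈ V, fderiv ℝ d z ≠ 0)
    (hnormal : ∃ c₀ : ℝ, 0 < c₀ ∧ ∀ v : ℂ × ℂ, fderiv ℝ d p v = c₀ * v.1.re) :
    ∃ U ∈ 𝓝 p, ∃ Ψ : (ℂ × ℂ) → (ℂ × ℂ) → (ℂ × ℂ), ∃ c : (ℂ × ℂ) → ℂ,
      -- continuity of the coordinate system in (q, z)
      ContinuousOn (fun qz : (ℂ × ℂ) × (ℂ × ℂ) => Ψ qz.1 qz.2)
        ((frontier Ω ∩ U) ×ˢ (Set.univ : Set (ℂ × ℂ))) ∧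
      -- c(q) → 1 as q → p along the boundary
      Tendsto c (𝓝[frontier Ω ∩ U] p) (𝓝 1) ∧
      ∀ q ∈ frontier Ω ∩ U,
        -- Ψ_q is a composition of a translation, a dilation and a triangular map
        (∃ h : Polynomial ℂ, h.natDegree ≤ r ∧ h.coeff 0 = 0 ∧ c q ≠ 0 ∧
          ∀ wz : ℂ × ℂ,
            Ψ q wz = (c q * (wz.1 - q.1) + h.eval (wz.2 - q.2), wz.2 - q.2)) ∧
        -- Ψ_q(q) = 0
        Ψ q q = 0 ∧ (c q).re ≠ 0 ∧
        -- the normalized local defining function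
        (∃ (coefP : ℕ × ℕ → ℂ) (R : ℂ → ℝ) (Q : ℝ → ℂ → ℝ),
          (∀ a b : ℕ, r < a + b → coefP (a, b) = 0) ∧
          (∀ a : ℕ, coefP (a, 0) = 0 ∧ coefP (0, a) = 0) ∧
          ((fun z : ℂ => R z) =o[𝓝 0] fun z : ℂ => ‖z‖ ^ r) ∧
          Continuous (fun tz : ℝ × ℂ => Q tz.1 tz.2) ∧ Q 0 0 = 0 ∧
          ∃ U' ∈ 𝓝 (0 : ℂ × ℂ),
            Ψ q '' (Ω ∩ U) ∩ U' = {wz ∈ U' |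
              wz.1.re
                + (∑ a ∈ Finset.range (r + 1), ∑ b ∈ Finset.range (r + 1),
                    coefP (a, b) * wz.2 ^ a * (starRingEnd ℂ wz.2) ^ b).re
                + R wz.2
                + (wz.1 / c q).im * Q ((wz.1 / c q).im) wz.2 < 0}) := by
  obtain ⟨c₀, hc₀, hnormal⟩ := hnormal
  have hpV : p ∈ V := mem_of_mem_nhds hV
  have hdp : d p = 0 := (hbdry.subset ⟨hp, hpV⟩).2
  obtain ⟨g, hg, hgp, hgraph⟩ := exists_smooth_graph hd hdp hc₀ hnormal
  obtain ⟨U, hUsub, hUo, hpU⟩ := eventually_nhds_iff.1 (hgraph.and hV)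
  have hβs : ContDiff ℝ (⊤ : ℕ∞) fun θ : ℝ × ℂ => fderiv ℝ g θ (1, 0) :=
    (hg.fderiv_right (m := (⊤ : ℕ∞)) (by simp)).clm_apply contDiff_const
  set β : ℝ × ℂ → ℝ := fun θ => fderiv ℝ g θ (1, 0) with hβ
  set γ : ℝ × ℂ → ℂ := fun θ => 1 + β θ * I with hγ
  have hγs : ContDiff ℝ (⊤ : ℕ∞) γ :=
    contDiff_const.add ((Complex.ofRealCLM.contDiff.comp hβs).mul contDiff_const)
  have hγre : ∀ θ, (γ θ).re = 1 := fun θ => by simp [hγ]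
  have hγ0 : ∀ θ, γ θ ≠ 0 := fun θ h => by simpa [h] using hγre θ
  set H : (ℝ × ℂ) × (ℝ × ℂ) → ℝ := fun x => g x.1 + β x.1 * x.2.1 - g (x.1 + x.2) with hH
  have hHs : ContDiff ℝ (⊤ : ℕ∞) H :=
    ((hg.comp contDiff_fst).add ((hβs.comp contDiff_fst).mul contDiff_snd.fst)).sub
      (hg.comp (contDiff_fst.add contDiff_snd))
  have hHslice : ∀ θ, ContDiff ℝ (⊤ : ℕ∞) fun v => H (θ, v) := fun θ =>
    hHs.comp (contDiff_const.prodMk contDiff_id)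
  have hHd : ∀ θ, fderiv ℝ (fun v => H (θ, v)) 0 (1, 0) = 0 := by
    intro θ
    have h1 : HasFDerivAt (fun v : ℝ × ℂ => g (θ + v)) (fderiv ℝ g θ) 0 := by
      have h := (hg.differentiable (by simp) (θ + 0)).hasFDerivAt.comp (0 : ℝ × ℂ)
        ((hasFDerivAt_id (0 : ℝ × ℂ)).const_add θ)
      rw [ContinuousLinearMap.comp_id, add_zero] at h
      exact h
    have h2 : HasFDerivAt (fun v : ℝ × ℂ => g θ + β θ * v.1 - g (θ + v))
        (β θ • ContinuousLinearMap.fst ℝ ℝ ℂ - fderiv ℝ g θ) 0 :=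
      ((hasFDerivAt_fst.const_mul (β θ)).const_add (g θ)).sub h1
    simp only [hH]
    rw [h2.fderiv]
    simp [hβ]
  obtain ⟨a, has, ha0, ha⟩ :=
    exists_smooth_normalization hHs (fun θ => by simp [hH]) hHd hγs hγ0 r
  set S : ℝ × ℂ → ℂ → ℂ := fun θ z => ∑ j ∈ Finset.range (r + 1), a j θ * z ^ j with hS
  have hScont : Continuous fun x : (ℝ × ℂ) × ℂ => S x.1 x.2 :=
    continuous_finsetSum _ fun j _ =>
      ((has j).continuous.comp continuous_fst).mul (continuous_snd.pow j)
  have hS0 : ∀ θ, S θ 0 = 0 := fun θ => by simp [hS, Finset.sum_range_succ', ha0]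
  have hγcont := hγs.continuous
  set π : ℂ × ℂ → ℝ × ℂ := fun q => (q.1.im, q.2) with hπ
  have hπcont : Continuous π := by fun_prop
  refine ⟨U, hUo.mem_nhds hpU,
    fun q wz => (γ (π q) * (wz.1 - q.1) + S (π q) (wz.2 - q.2), wz.2 - q.2), fun q => γ (π q),
    ?_, ?_, ?_⟩
  · refine Continuous.continuousOn ?_
    have h1 : Continuous fun x : (ℂ × ℂ) × (ℂ × ℂ) => S (π x.1) (x.2.2 - x.1.2) :=
      hScont.comp (f := fun x : (ℂ × ℂ) × (ℂ × ℂ) => (π x.1, x.2.2 - x.1.2)) (by fun_prop)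
    fun_prop
  · have h : Tendsto (fun q => γ (π q)) (𝓝 p) (𝓝 (γ (π p))) :=
      (hγcont.comp hπcont).tendsto p
    rw [show γ (π p) = 1 by simp [hγ, hβ, hπ, hgp]] at h
    exact h.mono_left nhdsWithin_le_nhds
  rintro q ⟨hqf, hqU⟩
  obtain ⟨⟨-, hq0⟩, hqV⟩ := hUsub q hqU
  have hqg : q.1.re = g (π q) := hq0.1 (hbdry.subset ⟨hqf, hqV⟩).2
  refine ⟨⟨∑ j ∈ Finset.range (r + 1), Polynomial.monomial j (a j (π q)), ?_, ?_, hγ0 _, ?_⟩,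
    by simp [hS0], by simp [hγre], ?_⟩
  · refine Polynomial.natDegree_sum_le_of_forall_le _ _ fun j hj => ?_
    exact (Polynomial.natDegree_monomial_le _).trans (Nat.lt_succ_iff.1 (Finset.mem_range.1 hj))
  · rw [Polynomial.finsetSum_coeff]
    refine Finset.sum_eq_zero fun j _ => ?_
    rcases eq_or_ne j 0 with rfl | hj
    · simp [ha0]
    · simp [Polynomial.coeff_monomial, hj]
  · intro wz
    simp [Polynomial.eval_finsetSum, hS]
  obtain ⟨C, hC, hCh, hCo⟩ := ha (π q)
  set θ := π q with hθ
  have hSθ : Continuous fun z => S θ z := hScont.comp (f := fun z : ℂ => (θ, z)) (by fun_prop)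
  obtain ⟨Q, hQ, hQ0, hQs⟩ := exists_divided_difference (hHslice θ)
    (Y := fun z => -(S θ z / γ θ).im) (by fun_prop)
  refine ⟨fun ab => C ab.1 ab.2,
    fun z => H (θ, (-(S θ z / γ θ).im, z)) - (S θ z).re - (mixedSum r C z).re, Q, hC, hCh, hCo,
    hQ, ?_, ?_⟩
  · simp only [hQ0, hS0, zero_div, Complex.zero_im, neg_zero]
    exact hHd θ
  set Φ : ℂ × ℂ → ℂ × ℂ := fun x => (q.1 + (x.1 - S θ x.2) / γ θ, q.2 + x.2) with hΦ
  have hΦcont : Continuous Φ := by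
    have : Continuous fun x : ℂ × ℂ => S θ x.2 := hSθ.comp continuous_snd
    fun_prop
  have hΦ0 : Φ 0 = q := by simp [hΦ, hS0]
  refine ⟨Φ ⁻¹' U, hΦcont.continuousAt.preimage_mem_nhds (by rw [hΦ0]; exact hUo.mem_nhds hqU), ?_⟩
  have hlevel : ∀ x : ℂ × ℂ, (Φ x).1.re - g ((Φ x).1.im, (Φ x).2) =
      x.1.re + (mixedSum r C x.2).re +
        (H (θ, (-(S θ x.2 / γ θ).im, x.2)) - (S θ x.2).re - (mixedSum r C x.2).re) +
        (x.1 / γ θ).im * Q (x.1 / γ θ).im x.2 := by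
    intro x
    set v := (x.1 - S θ x.2) / γ θ with hv
    have h1 := hQs (x.1 / γ θ).im x.2
    have h2 : (x.1 / γ θ).im + -(S θ x.2 / γ θ).im = v.im := by
      rw [hv, sub_div, Complex.sub_im]
      ring
    rw [h2] at h1
    have h3 : x.1.re = v.re - β θ * v.im + (S θ x.2).re := by
      have : x.1 = γ θ * v + S θ x.2 := by
        rw [hv]
        field_simp [hγ0 θ]
        ring
      rw [this]
      simp [hγ]
    have h4 : H (θ, (v.im, x.2)) = g θ + β θ * v.im - g (q.1.im + v.im, q.2 + x.2) := rfl
    have h5 : (Φ x).1.re - g ((Φ x).1.im, (Φ x).2) =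
        q.1.re + v.re - g (q.1.im + v.im, q.2 + x.2) := rfl
    rw [h5]
    linarith
  ext x
  have hmem : x ∈ (fun wz : ℂ × ℂ => (γ θ * (wz.1 - q.1) + S θ (wz.2 - q.2), wz.2 - q.2)) ''
      (Ω ∩ U) ↔ Φ x ∈ Ω ∩ U := by
    constructor
    · rintro ⟨w, hw, rfl⟩
      have : Φ (γ θ * (w.1 - q.1) + S θ (w.2 - q.2), w.2 - q.2) = w := by
        ext <;> simp [hΦ, hγ0 θ]
      rwa [this]
    · intro hx
      refine ⟨Φ x, hx, ?_⟩
      ext <;> simp [hΦ, hγ0 θ, mul_div_cancel₀]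
  have hΩ : Φ x ∈ U → (Φ x ∈ Ω ↔ (Φ x).1.re - g ((Φ x).1.im, (Φ x).2) < 0) := by
    intro hx
    obtain ⟨⟨hlt, -⟩, hxV⟩ := hUsub _ hx
    rw [sub_neg, ← hlt]
    exact ⟨fun h => (hdef.subset ⟨h, hxV⟩).2, fun h => (hdef.superset ⟨hxV, h⟩).1⟩
  constructor
  · rintro ⟨h1, hx⟩
    exact ⟨hx, (hlevel x).symm.trans_lt ((hΩ hx).1 (hmem.1 h1).1)⟩
  · rintro ⟨hx, h1⟩
    exact ⟨hmem.2 ⟨(hΩ hx).2 ((hlevel x).trans_lt h1), hx⟩, hx⟩
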